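/- arXiv:1801.00953 — 4 statements merged into one kernel-verified Lean document; each statement's English description precedes it below -/
import Mathlib

section
/- Let q be a real number with q > 1 and define the quantum integer [k] := (q^k - q^{-k})/(q - q^{-1}) for integers k. Then for every integer n ≥ 1, one has -[6][2]/[3] + [2n][n+1][n-1]/([2n+2][n]^2) + [n-1][6][2]/([n][2][3]) = -([2n+4][n+3][n+1])/([2n+2][n+2][n]). (This is the rational identity underlying the recursion for the trace of the clasp P_{n,0} in Kim's double-clasp expansion for the C2 spider.) -/
/-- Quantum integer `[k] = (q^k - q^{-k})/(q - q^{-1})` for a real parameter `q`. -/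
noncomputable def qi (q : ℝ) (k : ℤ) : ℝ := (q ^ k - q ^ (-k)) / (q - q⁻¹)

theorem qi_pos {q : ℝ} (hq : 1 < q) {k : ℤ} (hk : 0 < k) : 0 < qi q k := by
  have hinv : q⁻¹ < q := (inv_lt_one_of_one_lt₀ hq).trans hq
  have hpow : q ^ (-k) < q ^ k := zpow_lt_zpow_right₀ hq (by lia)
  exact div_pos (sub_pos.2 hpow) (sub_pos.2 hinv)

theorem qi_two_mul {q : ℝ} (hq : q ≠ 0) (k : ℤ) :
    qi q (2 * k) = qi q k * (q ^ k + q ^ (-k)) := by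
  have h₁ : q ^ (2 * k) = q ^ k * q ^ k := by rw [two_mul, zpow_add₀ hq]
  have h₂ : q ^ (-(2 * k)) = q ^ (-k) * q ^ (-k) := by rw [← zpow_add₀ hq]; congr 1; ring
  rw [qi, qi, h₁, h₂]
  ring

/-- The trace coefficient identity with all denominators cleared. -/
theorem clasp_trace_coefficient_identity_cleared {q : ℝ} (hq : 1 < q) (n : ℤ) :
    -((q ^ (3 : ℤ) + q ^ (-3 : ℤ)) * qi q 2 * (q ^ (n + 1) + q ^ (-(n + 1))) * qi q n)
        + (q ^ n + q ^ (-n)) * qi q (n - 1)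
        + qi q (n - 1) * (q ^ (3 : ℤ) + q ^ (-3 : ℤ)) * (q ^ (n + 1) + q ^ (-(n + 1)))
      = -((q ^ (n + 2) + q ^ (-(n + 2))) * qi q (n + 3)) := by
  have h0 : q ≠ 0 := by positivity
  have hd : q ^ 2 - 1 ≠ 0 := by nlinarith
  have hx : q ^ n ≠ 0 := zpow_ne_zero n h0
  have hden : q - q⁻¹ = (q ^ 2 - 1) / q := by field_simp
  simp only [qi, hden, zpow_neg, zpow_add₀ h0, zpow_sub₀ h0, zpow_ofNat]
  generalize q ^ n = x at hx ⊢
  field_simp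
  ring

/-- The rational identity underlying Kim's recursion for the trace of the clasp `P_{n,0}`. -/
theorem clasp_trace_coefficient_identity (q : ℝ) (hq : 1 < q) :
    ∀ n : ℤ, 1 ≤ n →
      -(qi q 6 * qi q 2) / qi q 3
        + qi q (2 * n) * qi q (n + 1) * qi q (n - 1) / (qi q (2 * n + 2) * (qi q n) ^ 2)
        + qi q (n - 1) * qi q 6 * qi q 2 / (qi q n * qi q 2 * qi q 3)
      = -(qi q (2 * n + 4) * qi q (n + 3) * qi q (n + 1))
          / (qi q (2 * n + 2) * qi q (n + 2) * qi q n) := by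
  intro n hn
  have hq0 : 0 < q := by positivity
  have h2 : qi q 2 ≠ 0 := (qi_pos hq (by lia)).ne'
  have h3 : qi q 3 ≠ 0 := (qi_pos hq (by lia)).ne'
  have hn0 : qi q n ≠ 0 := (qi_pos hq (by lia)).ne'
  have hn1 : qi q (n + 1) ≠ 0 := (qi_pos hq (by lia)).ne'
  have hn2 : qi q (n + 2) ≠ 0 := (qi_pos hq (by lia)).ne'
  have hc : q ^ (n + 1) + q ^ (-(n + 1)) ≠ 0 := by positivity
  have key := clasp_trace_coefficient_identity_cleared hq n
  rw [show (6 : ℤ) = 2 * 3 by norm_num, show 2 * n + 2 = 2 * (n + 1) by ring,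
    show 2 * n + 4 = 2 * (n + 2) by ring]
  simp only [qi_two_mul hq0.ne' 3, qi_two_mul hq0.ne' n, qi_two_mul hq0.ne' (n + 1),
    qi_two_mul hq0.ne' (n + 2)]
  generalize q ^ (n + 1) + q ^ (-(n + 1)) = c₁ at key hc ⊢
  generalize q ^ (n + 2) + q ^ (-(n + 2)) = c₂ at key ⊢
  generalize q ^ n + q ^ (-n) = c₀ at key ⊢
  generalize q ^ (3 : ℤ) + q ^ (-3 : ℤ) = c₃ at key ⊢
  field_simp
  linear_combination key
end

section
/- Let q be a real number with q > 1 and [k] := (q^k - q^{-k})/(q - q^{-1}). Suppose T : ℕ → ℝ satisfies T(1) = -[6][2]/[3] and, for every n ≥ 2, T(n) = T(n-1) · ( -[6][2]/[3] + [2n][n+1][n-1]/([2n+2][n]^2) + [n-1][6][2]/([n][2][3]) ). Then for every n ≥ 1, T(n) = (-1)^n · [2n+4][n+3][n+1]/([4][3]). (This is the evaluation of the trace of the clasp P_{n,0} in the C2 spider via Kim's recursion: the trace equals, up to the sign (-1)^n, the quantum dimension ([2n+4]/[4])·([n+3][n+1]/[3]) of the irreducible U_q(sp(4))-representation of highest weight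 (n,0).) -/
theorem qi_eq_of_zpow_eq {q x : ℝ} (hq : 1 < q) {k : ℤ} (hx : q ^ k = x) :
    qi q k = (x ^ 2 - 1) * q / (x * (q ^ 2 - 1)) := by
  have hq0 : q ≠ 0 := by positivity
  have hx0 : x ≠ 0 := hx ▸ zpow_ne_zero k hq0
  have hq2 : q ^ 2 - 1 ≠ 0 := by nlinarith
  have hq1 : q - q⁻¹ ≠ 0 := (sub_pos.2 ((inv_lt_one_of_one_lt₀ hq).trans hq)).ne'
  rw [qi, zpow_neg, hx]
  field_simp

/-- The coefficient in Kim's recursion for the trace of `P_{n,0}`, in closed form. -/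
theorem kim_coefficient {q : ℝ} (hq : 1 < q) {n : ℤ} (hn : 0 < n) :
    -(qi q 6 * qi q 2) / qi q 3
        + qi q (2 * n) * qi q (n + 1) * qi q (n - 1) / (qi q (2 * n + 2) * qi q n ^ 2)
        + qi q (n - 1) * qi q 6 * qi q 2 / (qi q n * qi q 2 * qi q 3)
      = -(qi q (2 * n + 4) * qi q (n + 3) * qi q (n + 1))
          / (qi q (2 * n + 2) * qi q (n + 2) * qi q n) := by
  have hq0 : q ≠ 0 := by positivity
  obtain ⟨y, hy⟩ : ∃ y, q ^ n = y := ⟨_, rfl⟩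
  have hy1 : 1 < y := hy ▸ one_lt_zpow₀ hq hn
  have hy0 : y ≠ 0 := by positivity
  have sub_one_ne_zero {x : ℝ} (hx : 1 < x) : x - 1 ≠ 0 := (sub_pos.2 hx).ne'
  have hqk (k : ℕ) (hk : k ≠ 0) : q ^ k - 1 ≠ 0 := sub_one_ne_zero (one_lt_pow₀ hq hk)
  have hq2 := hqk 2 (by norm_num)
  have hq4 := hqk 4 (by norm_num)
  have hq6 := hqk 6 (by norm_num)
  have hyn : y ^ 2 - 1 ≠ 0 := sub_one_ne_zero (one_lt_pow₀ hy1 (by norm_num))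
  have hyk (k : ℕ) (hk : k ≠ 0) : q ^ 4 * y ^ k - 1 ≠ 0 :=
    sub_one_ne_zero (one_lt_mul_of_le_of_lt (one_le_pow₀ hq.le) (one_lt_pow₀ hy1 hk))
  have hyq2 := hyk 2 (by norm_num)
  have hyq4 := hyk 4 (by norm_num)
  have e2 := qi_eq_of_zpow_eq hq (k := 2) (x := q ^ 2) (by norm_cast)
  have e3 := qi_eq_of_zpow_eq hq (k := 3) (x := q ^ 3) (by norm_cast)
  have e6 := qi_eq_of_zpow_eq hq (k := 6) (x := q ^ 6) (by norm_cast)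
  have en := qi_eq_of_zpow_eq hq hy
  have em := qi_eq_of_zpow_eq hq (k := n - 1) (x := y / q) (by rw [zpow_sub_one₀ hq0, hy]; rfl)
  have add_zpow (m : ℤ) (j : ℕ) : q ^ (m + j) = q ^ m * q ^ j := by
    rw [zpow_add₀ hq0, zpow_natCast]
  have two_mul_zpow : q ^ (2 * n) = y ^ 2 := by rw [mul_comm, zpow_mul, hy]; norm_cast
  have en1 := qi_eq_of_zpow_eq hq (k := n + 1) (x := y * q) (by simpa [hy] using add_zpow n 1)
  have en2 := qi_eq_of_zpow_eq hq (k := n + 2) (x := y * q ^ 2)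
    ((add_zpow n 2).trans (by rw [hy]))
  have en3 := qi_eq_of_zpow_eq hq (k := n + 3) (x := y * q ^ 3)
    ((add_zpow n 3).trans (by rw [hy]))
  have e2n := qi_eq_of_zpow_eq hq two_mul_zpow
  have e2n2 := qi_eq_of_zpow_eq hq (k := 2 * n + 2) (x := (y * q) ^ 2)
    ((add_zpow (2 * n) 2).trans (by rw [two_mul_zpow]; ring))
  have e2n4 := qi_eq_of_zpow_eq hq (k := 2 * n + 4) (x := y ^ 2 * q ^ 4)
    ((add_zpow (2 * n) 4).trans (by rw [two_mul_zpow]))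
  rw [e2, e3, e6, en, em, en1, en2, en3, e2n, e2n2, e2n4]
  simp only [mul_pow, ← pow_mul, Nat.reduceMul]
  field_simp
  ring

/-- Evaluation of the trace of the clasp `P_{n,0}` in the C2 spider via Kim's recursion:
the trace equals, up to the sign `(-1)^n`, the quantum dimension
`([2n+4]/[4])·([n+3][n+1]/[3])` of the irreducible `U_q(sp(4))`-representation of
highest weight `(n,0)`. -/
theorem clasp_trace_eval (q : ℝ) (hq : 1 < q) (T : ℕ → ℝ)
    (hT1 : T 1 = -(qi q 6 * qi q 2) / qi q 3)
    (hrec : ∀ n : ℕ, 2 ≤ n →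
      T n = T (n - 1) *
        (-(qi q 6 * qi q 2) / qi q 3
          + qi q (2 * (n : ℤ)) * qi q ((n : ℤ) + 1) * qi q ((n : ℤ) - 1)
              / (qi q (2 * (n : ℤ) + 2) * (qi q (n : ℤ)) ^ 2)
          + qi q ((n : ℤ) - 1) * qi q 6 * qi q 2 / (qi q (n : ℤ) * qi q 2 * qi q 3))) :
    ∀ n : ℕ, 1 ≤ n →
      T n = (-1) ^ n * (qi q (2 * (n : ℤ) + 4) * qi q ((n : ℤ) + 3) * qi q ((n : ℤ) + 1))
              / (qi q 4 * qi q 3) := by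
  intro n hn
  induction n, hn using Nat.le_induction with
  | base =>
    have h3 := (qi_pos hq (k := 3) (by norm_num)).ne'
    have h4 := (qi_pos hq (k := 4) (by norm_num)).ne'
    rw [hT1]
    norm_num
    field_simp
  | succ n hn ih =>
    have h2 := (qi_pos hq (k := 2 * ((n : ℤ) + 1) + 2) (by positivity)).ne'
    have h1 := (qi_pos hq (k := (n : ℤ) + 1) (by positivity)).ne'
    have h0 := (qi_pos hq (k := (n : ℤ) + 1 + 2) (by positivity)).ne'
    have h3 := (qi_pos hq (k := 3) (by norm_num)).ne'
    have h4 := (qi_pos hq (k := 4) (by norm_num)).ne'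
    rw [hrec (n + 1) (by lia), Nat.add_sub_cancel, ih]
    push_cast
    rw [kim_coefficient hq (n := (n : ℤ) + 1) (by positivity),
      show 2 * (n : ℤ) + 4 = 2 * ((n : ℤ) + 1) + 2 by ring,
      show (n : ℤ) + 3 = (n : ℤ) + 1 + 2 by ring]
    field_simp
    ring
end

section
/- Let k ≥ 0 be an integer, set N := 4k + 12, and define [s]_N := sin(2πs/N)/sin(2π/N) for integers s. Define the quantum dimension D(p) := [2p+4]_N [p+3]_N [p+1]_N / ([4]_N [3]_N). Then D(p) > 0 for every integer p with 0 ≤ p ≤ k, while D(k+1) = 0. (These are the traces, up to sign, of the clasps P_{p,0} in the C2 spider at q a primitive 2(2k+6)-th root of unity; the vanishing at p = k+1 is the negligibility threshold used to define the fusion category Sp(4)_k.) -/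
/-- Root-of-unity quantum integer `[s]_N = sin(2πs/N)/sin(2π/N)`, corresponding to
specializing the quantum integer at `q = e^{2πi/N}`. -/
noncomputable def qiN (N : ℝ) (s : ℤ) : ℝ :=
  Real.sin (2 * Real.pi * s / N) / Real.sin (2 * Real.pi / N)

/-- The quantum dimension `D(p) = [2p+4]_N [p+3]_N [p+1]_N / ([4]_N [3]_N)` of the
irreducible `U_q(sp(4))`-representation of highest weight `(p,0)`. -/
noncomputable def qdim (N : ℝ) (p : ℤ) : ℝ :=
  qiN N (2 * p + 4) * qiN N (p + 3) * qiN N (p + 1) / (qiN N 4 * qiN N 3)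

theorem sin_two_pi_mul_div_pos {N x : ℝ} (hx : 0 < x) (hxN : 2 * x < N) :
    0 < Real.sin (2 * Real.pi * x / N) := by
  have hN : 0 < N := by linarith
  have hpi := Real.pi_pos
  apply Real.sin_pos_of_pos_of_lt_pi (by positivity)
  rw [div_lt_iff₀ hN]
  nlinarith

theorem qiN_pos {N : ℝ} {s : ℤ} (hN : 2 < N) (hs : 0 < s) (hsN : 2 * (s : ℝ) < N) :
    0 < qiN N s := by
  have h1 := sin_two_pi_mul_div_pos (N := N) one_pos (by linarith)
  rw [mul_one] at h1
  exact div_pos (sin_two_pi_mul_div_pos (by exact_mod_cast hs) hsN) h1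

theorem qiN_eq_zero_of_two_mul_eq {N : ℝ} {s : ℤ} (hN : N ≠ 0) (hs : 2 * (s : ℝ) = N) :
    qiN N s = 0 := by
  have h : 2 * Real.pi * s / N = Real.pi := by
    rw [div_eq_iff hN, ← hs]
    ring
  rw [qiN, h, Real.sin_pi, zero_div]

/-- At `q` a primitive `2(2k+6)`-th root of unity (i.e. `N = 4k+12`), the quantum
dimensions `D(p)` are positive for `0 ≤ p ≤ k` and vanish at `p = k+1`: the
negligibility threshold defining the fusion category `Sp(4)_k`. -/
theorem qdim_pos_and_vanish (k : ℕ) :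
    (∀ p : ℕ, p ≤ k → 0 < qdim (4 * (k : ℝ) + 12) (p : ℤ)) ∧
      qdim (4 * (k : ℝ) + 12) ((k : ℤ) + 1) = 0 := by
  have hk : (0 : ℝ) ≤ k := k.cast_nonneg
  refine ⟨fun p hp => ?_, ?_⟩
  · have hpk : (p : ℝ) ≤ k := by exact_mod_cast hp
    have hpos : ∀ s : ℤ, 0 < s → 2 * (s : ℝ) < 4 * (k : ℝ) + 12 →
        0 < qiN (4 * (k : ℝ) + 12) s := fun s => qiN_pos (by linarith)
    refine div_pos (mul_pos (mul_pos ?_ ?_) ?_) (mul_pos ?_ ?_) <;>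
      apply hpos <;> first | positivity | (push_cast; linarith)
  · rw [qdim, qiN_eq_zero_of_two_mul_eq (s := 2 * ((k : ℤ) + 1) + 4) (by positivity)
      (by push_cast; ring)]
    simp
end

section
/- Let m, n ≥ 0 and i ≥ 1 be integers and let N be a real number with N > 8(m + n + i + 1). With [s]_N := sin(2πs/N)/sin(2π/N), α_t := [2t][t+1][t-1]/([2t+2][t]^2) and β_t := [t-1]/([t][2]) (all quantum integers taken at parameter N), the coefficient A_i := -[6][2]/[3] + α_{m+i} + α_{n+i} + ([6][2]/[3])(β_{n+i} + β_{m+i}) - [4][2] β_{n+i} β_{m+i} is strictly negative. (This is the key analytic estimate in the proof that the theta net θ((a,0),(b,0),(c,0)) is nonzero at roots of unity of sufficiently large order.) -/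
/-- The coefficient `α_t = [2t][t+1][t-1]/([2t+2][t]^2)`. -/
noncomputable def alphaN (N : ℝ) (t : ℤ) : ℝ :=
  qiN N (2 * t) * qiN N (t + 1) * qiN N (t - 1) / (qiN N (2 * t + 2) * (qiN N t) ^ 2)

/-- The coefficient `β_t = [t-1]/([t][2])`. -/
noncomputable def betaN (N : ℝ) (t : ℤ) : ℝ :=
  qiN N (t - 1) / (qiN N t * qiN N 2)

/-- The coefficient
`A_i = -[6][2]/[3] + α_{m+i} + α_{n+i} + ([6][2]/[3])(β_{n+i}+β_{m+i}) - [4][2]β_{n+i}β_{m+i}`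
from Kim's double-clasp expansion in the recursive evaluation of the theta net. -/
noncomputable def coeffA (N : ℝ) (m n : ℕ) (i : ℕ) : ℝ :=
  -(qiN N 6 * qiN N 2) / qiN N 3 + alphaN N ((m : ℤ) + i) + alphaN N ((n : ℤ) + i)
    + (qiN N 6 * qiN N 2 / qiN N 3) * (betaN N ((n : ℤ) + i) + betaN N ((m : ℤ) + i))
    - qiN N 4 * qiN N 2 * (betaN N ((n : ℤ) + i) * betaN N ((m : ℤ) + i))

open Real in
/-- With `τ = tan (2π/N)` and `p = [t-1]/([t] cos (2π/N))`, the coefficient `β_t` equals `p / 2`, and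
`p` and `α_t` are bounded by rational functions of `τ` as long as `2π(t+1)/N < π/4`. -/
lemma exists_betaN_eq_alphaN_le {N : ℝ} (hN : 0 < N) {t : ℤ} (ht : 1 ≤ t)
    (htN : 8 * ((t : ℝ) + 1) < N) :
    ∃ p : ℝ, betaN N t = p / 2 ∧ 0 ≤ p ∧
      p * (1 - tan (2 * π / N)) ≤ 1 - 2 * tan (2 * π / N) - tan (2 * π / N) ^ 2 ∧
      alphaN N t * (1 + tan (2 * π / N) ^ 2) ≤ (1 + tan (2 * π / N)) * p := by
  have hπ := pi_pos
  have ht' : (1 : ℝ) ≤ t := by exact_mod_cast ht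
  set x := 2 * π / N with hx
  have hx0 : 0 < x := by positivity
  have hq (s : ℤ) : qiN N s = sin (s * x) / sin x := by
    rw [qiN, hx]; congr 2; ring
  have htx : (t + 1) * x < π / 4 := by
    rw [hx, mul_div_assoc', div_lt_iff₀ hN]; nlinarith
  have hxt : x ≤ t * x := by nlinarith
  have hs : 0 < sin x := sin_pos_of_pos_of_lt_pi hx0 (by linarith)
  have hc : 0 < cos x := cos_pos_of_mem_Ioo ⟨by linarith, by linarith⟩
  have hS : 0 < sin (t * x) := sin_pos_of_pos_of_lt_pi (by linarith) (by linarith)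
  have hC : 0 < cos (t * x) := cos_pos_of_mem_Ioo ⟨by linarith, by linarith⟩
  have hS1 : 0 < sin ((t + 1) * x) := sin_pos_of_pos_of_lt_pi (by linarith) (by linarith)
  have hC1 : 0 < cos ((t + 1) * x) := cos_pos_of_mem_Ioo ⟨by linarith, by linarith⟩
  have hS0 : 0 ≤ sin ((t - 1) * x) :=
    sin_nonneg_of_nonneg_of_le_pi (by linarith) (by linarith)
  have hlt : sin ((t + 1) * x) < cos ((t + 1) * x) := by
    rw [← sin_pi_div_two_sub]
    exact sin_lt_sin_of_lt_of_le_pi_div_two (by linarith) (by linarith) (by linarith)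
  have hα : alphaN N t =
      cos (t * x) * sin ((t - 1) * x) / (cos ((t + 1) * x) * sin (t * x)) := by
    have e1 : ((2 * t : ℤ) : ℝ) * x = 2 * (t * x) := by push_cast; ring
    have e2 : ((2 * t + 2 : ℤ) : ℝ) * x = 2 * ((t + 1) * x) := by push_cast; ring
    rw [alphaN]
    simp only [hq]
    rw [e1, e2, sin_two_mul, sin_two_mul]
    push_cast
    generalize sin ((t - 1) * x) = u, sin ((t + 1) * x) = v, cos ((t + 1) * x) = w at *
    field_simp
  have hβ : betaN N t = sin ((t - 1) * x) / (cos x * sin (t * x)) / 2 := by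
    rw [betaN]
    simp only [hq]
    push_cast
    rw [sin_two_mul]
    field_simp
  refine ⟨_, hβ, by positivity, ?_, ?_⟩ <;> rw [tan_eq_sin_div_cos]
  all_goals
    have a1 : sin ((t + 1) * x) = sin (t * x) * cos x + cos (t * x) * sin x := by
      rw [add_mul, one_mul, sin_add]
    have a2 : cos ((t + 1) * x) = cos (t * x) * cos x - sin (t * x) * sin x := by
      rw [add_mul, one_mul, cos_add]
    have a3 : sin ((t - 1) * x) = sin (t * x) * cos x - cos (t * x) * sin x := by
      rw [sub_mul, one_mul, sin_sub]
  · rw [a1, a2] at hlt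
    rw [a3, ← sub_nonneg]
    have : 1 - 2 * (sin x / cos x) - (sin x / cos x) ^ 2 -
        (sin (t * x) * cos x - cos (t * x) * sin x) / (cos x * sin (t * x)) * (1 - sin x / cos x) =
        sin x * (cos (t * x) * cos x - sin (t * x) * sin x -
          (sin (t * x) * cos x + cos (t * x) * sin x)) / (cos x ^ 2 * sin (t * x)) := by
      field_simp
      ring
    rw [this]
    exact div_nonneg (mul_nonneg hs.le (by linarith)) (by positivity)
  · rw [hα, ← sub_nonneg]
    have : (1 + sin x / cos x) * (sin ((t - 1) * x) / (cos x * sin (t * x))) -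
        cos (t * x) * sin ((t - 1) * x) / (cos ((t + 1) * x) * sin (t * x)) *
          (1 + (sin x / cos x) ^ 2) =
        sin ((t - 1) * x) * ((cos x + sin x) * cos ((t + 1) * x) -
          cos (t * x) * (cos x ^ 2 + sin x ^ 2)) /
          (cos x ^ 2 * sin (t * x) * cos ((t + 1) * x)) := by
      generalize sin ((t - 1) * x) = u, cos ((t + 1) * x) = v at *
      field_simp
    rw [this]
    refine div_nonneg (mul_nonneg hS0 ?_) (by positivity)
    have e : (cos x + sin x) * cos ((t + 1) * x) - cos (t * x) * (cos x ^ 2 + sin x ^ 2) =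
        sin x * (cos ((t + 1) * x) - sin ((t + 1) * x)) := by
      rw [a1, a2]; ring
    rw [e]
    exact mul_nonneg hs.le (by linarith)

open Real in
lemma qiN_six_mul_two_div_three {N : ℝ} (hN : 16 < N) :
    qiN N 6 * qiN N 2 / qiN N 3 =
      4 * (1 - 3 * tan (2 * π / N) ^ 2) / (1 + tan (2 * π / N) ^ 2) ^ 2 := by
  have hπ := pi_pos
  set x := 2 * π / N with hx
  have hx0 : 0 < x := by positivity
  have hx8 : x < π / 8 := by
    rw [hx, div_lt_iff₀ (by linarith)]; nlinarith
  have hq (s : ℤ) : qiN N s = sin (s * x) / sin x := by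
    rw [qiN, hx]; congr 2; ring
  have hs : 0 < sin x := sin_pos_of_pos_of_lt_pi hx0 (by linarith)
  have hc : 0 < cos x := cos_pos_of_mem_Ioo ⟨by linarith, by linarith⟩
  have hs3 : 0 < sin (3 * x) := sin_pos_of_pos_of_lt_pi (by linarith) (by linarith)
  simp only [hq]
  push_cast
  rw [show (6 : ℝ) * x = 2 * (3 * x) by ring, sin_two_mul, sin_two_mul, tan_eq_sin_div_cos]
  have e : 1 + (sin x / cos x) ^ 2 = 1 / cos x ^ 2 := by
    field_simp; rw [add_comm, sin_sq_add_cos_sq]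
  rw [e]
  field_simp
  rw [cos_three_mul, sin_sq]
  ring

open Real in
lemma qiN_four_mul_two {N : ℝ} (hN : 16 < N) :
    qiN N 4 * qiN N 2 =
      8 * (1 - tan (2 * π / N) ^ 2) / (1 + tan (2 * π / N) ^ 2) ^ 2 := by
  have hπ := pi_pos
  set x := 2 * π / N with hx
  have hx0 : 0 < x := by positivity
  have hx8 : x < π / 8 := by
    rw [hx, div_lt_iff₀ (by linarith)]; nlinarith
  have hq (s : ℤ) : qiN N s = sin (s * x) / sin x := by
    rw [qiN, hx]; congr 2; ring
  have hs : 0 < sin x := sin_pos_of_pos_of_lt_pi hx0 (by linarith)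
  have hc : 0 < cos x := cos_pos_of_mem_Ioo ⟨by linarith, by linarith⟩
  simp only [hq]
  push_cast
  rw [show (4 : ℝ) * x = 2 * (2 * x) by ring, sin_two_mul, sin_two_mul, tan_eq_sin_div_cos]
  have e : 1 + (sin x / cos x) ^ 2 = 1 / cos x ^ 2 := by
    field_simp; rw [add_comm, sin_sq_add_cos_sq]
  rw [e]
  field_simp
  rw [cos_two_mul, sin_sq]
  ring

lemma bilinear_bound {t p q : ℝ} (ht : 0 < t) (hp : 0 ≤ p) (hq : 0 ≤ q)
    (hpt : p * (1 - t) ≤ 1 - 2 * t - t ^ 2) (hqt : q * (1 - t) ≤ 1 - 2 * t - t ^ 2) (ht1 : t < 1) :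
    -(4 * (1 - 3 * t ^ 2)) + ((1 + t) * (1 + t ^ 2) + 2 * (1 - 3 * t ^ 2)) * (p + q) -
      2 * (1 - t ^ 2) * (p * q) < 0 := by
  have ht2 : 0 < 1 - t := by linarith
  have hD : 0 ≤ 1 - 2 * t - t ^ 2 := (mul_nonneg hp ht2.le).trans hpt
  obtain ⟨r, hr⟩ : ∃ r, r * (1 - t) = 1 - 2 * t - t ^ 2 := ⟨_, div_mul_cancel₀ _ ht2.ne'⟩
  have hpr : p ≤ r := le_of_mul_le_mul_right (hpt.trans hr.ge) ht2
  have hqr : q ≤ r := le_of_mul_le_mul_right (hqt.trans hr.ge) ht2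
  have hr1 : r ≤ 1 := le_of_mul_le_mul_right (a := 1 - t) (by nlinarith) ht2
  set B := (1 + t) * (1 + t ^ 2) + 2 * (1 - 3 * t ^ 2) with hB
  have hw : 0 < 1 - t ^ 2 := by nlinarith
  have hBw : 0 ≤ B - 2 * (1 - t ^ 2) := by
    rw [hB]; nlinarith [pow_pos ht 3]
  have h1 : 0 ≤ (r - p) * (B - 2 * (1 - t ^ 2) * q) :=
    mul_nonneg (by linarith) (by nlinarith)
  have h2 : 0 ≤ (r - q) * (B - 2 * (1 - t ^ 2) * r) :=
    mul_nonneg (by linarith) (by nlinarith)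
  have h3 : -(4 * (1 - 3 * t ^ 2)) + B * (r + r) - 2 * (1 - t ^ 2) * (r * r) < 0 := by
    refine neg_of_mul_neg_left (b := (1 - t) ^ 2) ?_ (by positivity)
    have : (-(4 * (1 - 3 * t ^ 2)) + B * (r + r) - 2 * (1 - t ^ 2) * (r * r)) * (1 - t) ^ 2 =
        -(4 * (t ^ 2 * (1 - t ^ 2) * (1 + t ^ 2))) := by
      rw [hB]
      linear_combination (2 * ((1 + t) * (1 + t ^ 2) + 2 * (1 - 3 * t ^ 2)) * (1 - t) -
        2 * (1 - t ^ 2) * (r * (1 - t) + (1 - 2 * t - t ^ 2))) * hr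
    rw [this]
    have : 0 < t ^ 2 * (1 - t ^ 2) * (1 + t ^ 2) := by positivity
    linarith
  nlinarith

open Real in
/-- The key analytic estimate: for `N > 8(m+n+i+1)` the coefficient `A_i` is strictly
negative. -/
theorem coeffA_neg (m n i : ℕ) (hi : 1 ≤ i) (N : ℝ)
    (hN : 8 * ((m : ℝ) + n + i + 1) < N) :
    coeffA N m n i < 0 := by
  have hi' : (1 : ℝ) ≤ i := by exact_mod_cast hi
  have hm : (0 : ℝ) ≤ m := m.cast_nonneg
  have hn : (0 : ℝ) ≤ n := n.cast_nonneg
  have hN16 : 16 < N := by linarith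
  obtain ⟨p, hβp, hp, hpt, hαp⟩ := exists_betaN_eq_alphaN_le (N := N) (t := (m : ℤ) + i)
    (by linarith) (by lia) (by push_cast; linarith)
  obtain ⟨q, hβq, hq, hqt, hαq⟩ := exists_betaN_eq_alphaN_le (N := N) (t := (n : ℤ) + i)
    (by linarith) (by lia) (by push_cast; linarith)
  have hx : 2 * π / N < π / 4 := by
    rw [div_lt_iff₀ (by linarith)]; nlinarith [pi_pos]
  have ht0 : 0 < tan (2 * π / N) :=
    tan_pos_of_pos_of_lt_pi_div_two (div_pos two_pi_pos (by linarith)) (by linarith [pi_pos])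
  have ht1 : tan (2 * π / N) < 1 := by
    rw [← tan_pi_div_four]
    have := div_pos two_pi_pos (show 0 < N by linarith)
    exact tan_lt_tan_of_lt_of_lt_pi_div_two (by linarith [pi_pos]) (by linarith [pi_pos]) hx
  rw [coeffA, neg_div, qiN_six_mul_two_div_three hN16, qiN_four_mul_two hN16, hβp, hβq]
  generalize tan (2 * π / N) = t at *
  have hb := bilinear_bound ht0 hp hq hpt hqt ht1
  have hw : 0 < 1 + t ^ 2 := by positivity
  refine neg_of_mul_neg_left (b := (1 + t ^ 2) ^ 2) ?_ (by positivity)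
  have hα := mul_le_mul_of_nonneg_right (add_le_add hαp hαq) hw.le
  field_simp
  linarith
end
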